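/- Let Ω = F⁻¹·( exp((1+x¹)x³) dx¹∧dx² + dx³∧dx⁴ ) be a germ of a 2-form of type 3 at the origin of ℝ⁴, where F is smooth with F(0) = 1. Then Ω is of type 3.3 if and only if both (F_{x²}F_{x²x⁴} − F_{x⁴}F_{x²x²})²(0) + (F_{x²}F_{x⁴x⁴} − F_{x⁴}F_{x²x⁴})²(0) > 0 and F_{x²x²}F_{x⁴x⁴} − (F_{x²x⁴})² = 0 identically near the origin; and Ω is of type 3.4 if and only if F_{x²x²}(0)·F_{x⁴x⁴}(0) − (F_{x²x⁴}(0))² ≠ 0. (Subscripts denote partial derivatives.) -/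

import Mathlib

/-!  Coordinate formalization of differential forms in four variables,
     following "The equivalence problem of differential 2-forms in 4 variables". -/

open Real Filter

/-- Points of `ℝ⁴`; the coordinates `x¹, x², x³, x⁴` of the paper are `x 0, x 1, x 2, x 3`. -/
abbrev Pt := Fin 4 → ℝ

/-- Partial derivative `∂f/∂xⁱ`. -/
noncomputable def pd (i : Fin 4) (f : Pt → ℝ) (x : Pt) : ℝ :=
  fderiv ℝ f x (Pi.single i 1)

/-- Second partial derivative `∂²f/∂xⁱ∂xʲ`. -/
noncomputable def pd2 (i j : Fin 4) (f : Pt → ℝ) (x : Pt) : ℝ :=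
  pd i (fun y => pd j f y) x

/-- Differential forms of degree 0,1,2,3,4 on `ℝ⁴`, given by their (skew-symmetric)
    coordinate components, and vector fields. -/
abbrev Form0 := Pt → ℝ
abbrev Form1 := Pt → Fin 4 → ℝ
abbrev Form2 := Pt → Fin 4 → Fin 4 → ℝ
abbrev Form3 := Pt → Fin 4 → Fin 4 → Fin 4 → ℝ
abbrev Form4 := Pt → Fin 4 → Fin 4 → Fin 4 → Fin 4 → ℝ
abbrev Vec := Pt → Fin 4 → ℝ

/-- A 2-form has skew-symmetric components. -/
def Alt2 (B : Form2) : Prop := ∀ x i j, B x i j = - B x j i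

/-- Exterior derivative of a function. -/
noncomputable def d0 (f : Form0) : Form1 := fun x i => pd i f x

/-- Exterior derivative of a 1-form. -/
noncomputable def d1 (ω : Form1) : Form2 := fun x i j =>
  pd i (fun y => ω y j) x - pd j (fun y => ω y i) x

/-- Exterior derivative of a 2-form. -/
noncomputable def d2 (B : Form2) : Form3 := fun x i j k =>
  pd i (fun y => B y j k) x - pd j (fun y => B y i k) x + pd k (fun y => B y i j) x

/-- Wedge product of two 1-forms. -/
def w11 (ω η : Form1) : Form2 := fun x i j => ω x i * η x j - ω x j * η x i

/-- Wedge product of a 1-form and a 2-form. -/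
def w12 (ω : Form1) (B : Form2) : Form3 := fun x i j k =>
  ω x i * B x j k - ω x j * B x i k + ω x k * B x i j

/-- Wedge product of a 1-form and a 3-form. -/
def w13 (ω : Form1) (C : Form3) : Form4 := fun x i j k l =>
  ω x i * C x j k l - ω x j * C x i k l + ω x k * C x i j l - ω x l * C x i j k

/-- Wedge product of two 2-forms. -/
def w22 (A B : Form2) : Form4 := fun x i j k l =>
  A x i j * B x k l - A x i k * B x j l + A x i l * B x j k
    + A x j k * B x i l - A x j l * B x i k + A x k l * B x i j

/-- A 2-form is of rank 4 when `Ω ∧ Ω` vanishes nowhere. -/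
def Rank4 (B : Form2) : Prop := ∀ x, w22 B B x ≠ 0

/-- Interior products `i_X`. -/
def i1 (X : Vec) (ω : Form1) : Form0 := fun x => ∑ i, X x i * ω x i
def i2 (X : Vec) (B : Form2) : Form1 := fun x j => ∑ i, X x i * B x i j
def i3 (X : Vec) (C : Form3) : Form2 := fun x j k => ∑ i, X x i * C x i j k
def i4 (X : Vec) (D : Form4) : Form3 := fun x j k l => ∑ i, X x i * D x i j k l

/-- Evaluation `B(X,Y)` of a 2-form on two vector fields. -/
def ev2 (B : Form2) (X Y : Vec) : Form0 := fun x => ∑ i, ∑ j, X x i * Y x j * B x i j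

/-- Evaluation `D(X,Y,Z,W)` of a 4-form on four vector fields. -/
def ev4 (D : Form4) (X Y Z W : Vec) : Form0 := fun x =>
  ∑ i, ∑ j, ∑ k, ∑ l, X x i * Y x j * Z x k * W x l * D x i j k l

/-- Lie derivative of a 1-form (Cartan's magic formula). -/
noncomputable def lie1 (X : Vec) (ω : Form1) : Form1 := fun x i =>
  d0 (i1 X ω) x i + i2 X (d1 ω) x i

/-- Lie derivative of a 2-form (Cartan's magic formula). -/
noncomputable def lie2 (X : Vec) (B : Form2) : Form2 := fun x i j =>
  d1 (i2 X B) x i j + i3 X (d2 B) x i j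

/-- Lie bracket of two vector fields. -/
noncomputable def bracket (X Y : Vec) : Vec := fun x i =>
  ∑ j, (X x j * pd j (fun y => Y y i) x - Y x j * pd j (fun y => X y i) x)

/-- Derivative `X(f)` of a function along a vector field. -/
noncomputable def dirDeriv (X : Vec) (f : Form0) : Form0 := fun x => ∑ j, X x j * pd j f x

/-- Pullback of a 1-form under a smooth map. -/
noncomputable def pull1 (φ : Pt → Pt) (ω : Form1) : Form1 := fun x i =>
  ∑ a, ω (φ x) a * pd i (fun y => φ y a) x

/-- Pullback of a 2-form under a smooth map. -/
noncomputable def pull2 (φ : Pt → Pt) (B : Form2) : Form2 := fun x i j =>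
  ∑ a, ∑ b, B (φ x) a b * pd i (fun y => φ y a) x * pd j (fun y => φ y b) x

/-- A pair of mutually inverse smooth maps: a diffeomorphism of `ℝ⁴` (with inverse). -/
def IsDiffeo (φ ψ : Pt → Pt) : Prop :=
  ContDiff ℝ (⊤ : ℕ∞) φ ∧ ContDiff ℝ (⊤ : ℕ∞) ψ ∧ (∀ x, ψ (φ x) = x) ∧ (∀ x, φ (ψ x) = x)

/-- The covector with components `c` as a linear functional on the tangent space `ℝ⁴`. -/
noncomputable def covec (c : Fin 4 → ℝ) : Pt →ₗ[ℝ] ℝ :=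
  ∑ i, c i • (LinearMap.proj i : Pt →ₗ[ℝ] ℝ)

/-- The class of a 1-form `ω` at `x`: the codimension of the space of tangent vectors `v`
    with `i_v ω = 0` and `i_v (dω) = 0`. -/
noncomputable def classAt (ω : Form1) (x : Pt) : ℕ :=
  4 - Module.finrank ℝ
    ↥(LinearMap.ker (covec (ω x)) ⊓ ⨅ j, LinearMap.ker (covec (fun i => d1 ω x i j)))

/-- Components of the constant 2-form `dxᵃ ∧ dxᵇ`. -/
def dxw (a b : Fin 4) : Fin 4 → Fin 4 → ℝ := fun i j =>
  (if i = a ∧ j = b then (1:ℝ) else 0) - (if i = b ∧ j = a then (1:ℝ) else 0)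

/-- A germ of 2-form (with associated 1-form `ω = ω_Ω`) is of type `t` at `x₀`:
    `ω` is nonsingular at `x₀` and of constant class `t` near `x₀`. -/
def IsTypeAt (ω : Form1) (t : ℕ) (x₀ : Pt) : Prop :=
  ω x₀ ≠ 0 ∧ ∀ᶠ x in nhds x₀, classAt ω x = t

lemma pd_congr {f g : Pt → ℝ} {x : Pt} (i : Fin 4) (h : f =ᶠ[nhds x] g) : pd i f x = pd i g x := by
  unfold pd; rw [h.fderiv_eq]

lemma pd_mul {f g : Pt → ℝ} {x : Pt} (i : Fin 4) (hf : DifferentiableAt ℝ f x)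
    (hg : DifferentiableAt ℝ g x) :
    pd i (fun y => f y * g y) x = pd i f x * g x + f x * pd i g x := by
  unfold pd
  rw [fderiv_fun_mul hf hg]
  simp; ring

lemma pd_add {f g : Pt → ℝ} {x : Pt} (i : Fin 4) (hf : DifferentiableAt ℝ f x)
    (hg : DifferentiableAt ℝ g x) :
    pd i (fun y => f y + g y) x = pd i f x + pd i g x := by
  unfold pd
  rw [fderiv_fun_add hf hg]
  simp

lemma pd_neg {f : Pt → ℝ} {x : Pt} (i : Fin 4) :
    pd i (fun y => - f y) x = - pd i f x := by
  unfold pd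
  rw [fderiv_fun_neg]
  simp

lemma pd_const (c : ℝ) {x : Pt} (i : Fin 4) : pd i (fun _ => c) x = 0 := by
  unfold pd; simp

lemma pd_coord (j : Fin 4) {x : Pt} (i : Fin 4) :
    pd i (fun y => y j) x = if j = i then 1 else 0 := by
  unfold pd
  have : HasFDerivAt (fun y : Pt => y j) (ContinuousLinearMap.proj (R := ℝ) (φ := fun _ => ℝ) j) x :=
    (ContinuousLinearMap.proj (R := ℝ) (φ := fun _ : Fin 4 => ℝ) j).hasFDerivAt
  rw [this.fderiv]
  simp [Pi.single_apply]

lemma pd_inv {f : Pt → ℝ} {x : Pt} (i : Fin 4) (hf : DifferentiableAt ℝ f x) (h0 : f x ≠ 0) :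
    pd i (fun y => (f y)⁻¹) x = - pd i f x * ((f x)⁻¹) ^ 2 := by
  unfold pd
  have := (hasDerivAt_inv h0).comp_hasFDerivAt x hf.hasFDerivAt
  have h2 := this.fderiv
  simp only [Function.comp_def] at h2
  rw [h2]
  simp; ring

lemma pd_exp {f : Pt → ℝ} {x : Pt} (i : Fin 4) (hf : DifferentiableAt ℝ f x) :
    pd i (fun y => Real.exp (f y)) x = Real.exp (f x) * pd i f x := by
  unfold pd
  rw [fderiv_exp hf]
  simp

lemma pd_phase {x : Pt} (i : Fin 4) :
    pd i (fun y => (1 + y 0) * y 2) x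
      = (if 0 = i then 1 else 0) * x 2 + (1 + x 0) * (if 2 = i then 1 else 0) := by
  rw [pd_mul i (by fun_prop) (by fun_prop), pd_add i (by fun_prop) (by fun_prop), pd_const,
    pd_coord, pd_coord]
  ring

lemma contDiff_pd {F : Pt → ℝ} (hF : ContDiff ℝ (⊤ : ℕ∞) F) (i : Fin 4) :
    ContDiff ℝ (⊤ : ℕ∞) (fun y => pd i F y) := by
  unfold pd
  exact (hF.fderiv_right (m := (⊤ : ℕ∞)) (by exact_mod_cast le_top)).clm_apply contDiff_const

lemma pd2_symm {F : Pt → ℝ} (hF : ContDiff ℝ (⊤ : ℕ∞) F) (i j : Fin 4) (x : Pt) :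
    pd2 i j F x = pd2 j i F x := by
  have hs : IsSymmSndFDerivAt ℝ F x :=
    hF.contDiffAt.isSymmSndFDerivAt (by simp; exact WithTop.coe_le_coe.2 (le_top : (2 : ℕ∞) ≤ ⊤))
  have hd : DifferentiableAt ℝ (fderiv ℝ F) x :=
    ((hF.fderiv_right (m := (⊤ : ℕ∞)) (by exact_mod_cast le_top)).differentiable (by simp)) x
  have key : ∀ i j : Fin 4, pd2 i j F x
      = fderiv ℝ (fderiv ℝ F) x (Pi.single i 1) (Pi.single j 1) := by
    intro i j
    unfold pd2 pd
    rw [fderiv_clm_apply hd (differentiableAt_const _)]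
    simp
  rw [key, key]
  exact hs _ _

/-- The linear algebra behind the classes 3 and 4. -/
lemma class_lin (a b a1 a3 b1 b3 c : ℝ) (K : Submodule ℝ Pt)
    (hK : ∀ v : Pt, v ∈ K ↔ (a * v 0 + b * v 2 = 0 ∧ a1 * v 1 + a3 * v 3 - c * v 2 = 0 ∧
      a1 * v 0 + b1 * v 2 = 0 ∧ c * v 0 + b1 * v 1 + b3 * v 3 = 0 ∧ a3 * v 0 + b3 * v 2 = 0)) :
    (4 - Module.finrank ℝ K = 4 ↔ a1 * b3 - a3 * b1 ≠ 0) ∧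
    (4 - Module.finrank ℝ K = 3 ↔ a1 * b3 - a3 * b1 = 0 ∧
      (a * b1 - b * a1 ≠ 0 ∨ a * b3 - b * a3 ≠ 0)) := by
  have e4 : 4 - Module.finrank ℝ K = 4 ↔ Module.finrank ℝ K = 0 := by omega
  have e3 : 4 - Module.finrank ℝ K = 3 ↔ Module.finrank ℝ K = 1 := by omega
  have n1 : a1 * b3 - a3 * b1 = 0 → (![0, a3, 0, -a1] : Pt) ∈ K := by
    intro h; rw [hK]; simp; constructor <;> first | linear_combination (0 : ℝ) * h | linear_combination h | linear_combination -h
  have n2 : a1 * b3 - a3 * b1 = 0 → (![0, b3, 0, -b1] : Pt) ∈ K := by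
    intro h; rw [hK]; simp; constructor <;> first | linear_combination (0 : ℝ) * h | linear_combination h | linear_combination -h
  have z1 : a1 = 0 → b1 = 0 → (![0, 1, 0, 0] : Pt) ∈ K := by
    intro h h'; rw [hK]; simp [h, h']
  have z3 : a3 = 0 → b3 = 0 → (![0, 0, 0, 1] : Pt) ∈ K := by
    intro h h'; rw [hK]; simp [h, h']
  have hz : Module.finrank ℝ K = 0 ↔ a1 * b3 - a3 * b1 ≠ 0 := by
    rw [Submodule.finrank_eq_zero, Submodule.eq_bot_iff]
    constructor
    · intro h hD
      have h1 := h _ (n1 hD)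
      have h2 := h _ (n2 hD)
      have q1 := congrFun h1 1
      have q3 := congrFun h1 3
      have r1 := congrFun h2 1
      have r3 := congrFun h2 3
      simp at q1 q3 r1 r3
      have := congrFun (h _ (z1 q3 r3)) 1
      simp at this
    · intro hD v hv
      obtain ⟨_, e2, e3, e4, e5⟩ := (hK v).1 hv
      have v0 : v 0 = 0 := by
        have : (a1 * b3 - a3 * b1) * v 0 = 0 := by linear_combination b3 * e3 - b1 * e5
        exact (mul_eq_zero.1 this).resolve_left hD
      have v2 : v 2 = 0 := by
        have : (a1 * b3 - a3 * b1) * v 2 = 0 := by linear_combination a1 * e5 - a3 * e3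
        exact (mul_eq_zero.1 this).resolve_left hD
      rw [v2] at e2
      rw [v0] at e4
      have v1 : v 1 = 0 := by
        have : (a1 * b3 - a3 * b1) * v 1 = 0 := by linear_combination b3 * e2 - a3 * e4
        exact (mul_eq_zero.1 this).resolve_left hD
      have v3 : v 3 = 0 := by
        have : (a1 * b3 - a3 * b1) * v 3 = 0 := by linear_combination a1 * e4 - b1 * e2
        exact (mul_eq_zero.1 this).resolve_left hD
      ext i; fin_cases i <;> simp [v0, v1, v2, v3]
  refine ⟨e4.trans hz, e3.trans ?_⟩
  constructor
  · intro h1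
    have hD : a1 * b3 - a3 * b1 = 0 := by
      by_contra hD
      rw [hz.2 hD] at h1; exact absurd h1 (by norm_num)
    refine ⟨hD, ?_⟩
    by_contra! hPQ
    obtain ⟨hP, hQ⟩ := hPQ
    obtain ⟨g, -, hg⟩ := finrank_eq_one_iff'.1 h1
    have minor : ∀ v ∈ K, ∀ w ∈ K, ∀ i j : Fin 4, v i * w j = v j * w i := by
      intro v hv w hw i j
      obtain ⟨s, hs⟩ := hg ⟨v, hv⟩
      obtain ⟨t, ht⟩ := hg ⟨w, hw⟩
      have hs' : s • (g : Pt) = v := congrArg Subtype.val hs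
      have ht' : t • (g : Pt) = w := congrArg Subtype.val ht
      rw [← hs', ← ht']
      simp; ring
    have m1 : (![-b1, c, a1, 0] : Pt) ∈ K := by
      rw [hK]; simp
      refine ⟨?_, ?_, ?_, ?_, ?_⟩
      · linear_combination -hP
      · ring
      · ring
      · ring
      · linear_combination hD
    have m3 : (![-b3, 0, a3, c] : Pt) ∈ K := by
      rw [hK]; simp
      refine ⟨?_, ?_, ?_, ?_, ?_⟩
      · linear_combination -hQ
      · ring
      · linear_combination -hD
      · ring
      · ring
    have ha1 : a1 = 0 := by simpa using minor _ m1 _ (n1 hD) 2 3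
    have hb1 : b1 = 0 := by simpa using minor _ m1 _ (n2 hD) 0 3
    have ha3 : a3 = 0 := by simpa using minor _ m3 _ (n1 hD) 2 1
    have hb3 : b3 = 0 := by simpa using minor _ m3 _ (n2 hD) 0 1
    have := minor _ (z1 ha1 hb1) _ (z3 ha3 hb3) 1 3
    simp at this
  · rintro ⟨hD, hPQ⟩
    have v02 : ∀ v ∈ K, v 0 = 0 ∧ v 2 = 0 := by
      intro v hv
      obtain ⟨e1, e2, e3, e4, e5⟩ := (hK v).1 hv
      rcases hPQ with h | h
      · constructor
        · have : (a * b1 - b * a1) * v 0 = 0 := by linear_combination b1 * e1 - b * e3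
          exact (mul_eq_zero.1 this).resolve_left h
        · have : (a * b1 - b * a1) * v 2 = 0 := by linear_combination a * e3 - a1 * e1
          exact (mul_eq_zero.1 this).resolve_left h
      · constructor
        · have : (a * b3 - b * a3) * v 0 = 0 := by linear_combination b3 * e1 - b * e5
          exact (mul_eq_zero.1 this).resolve_left h
        · have : (a * b3 - b * a3) * v 2 = 0 := by linear_combination a * e5 - a3 * e1
          exact (mul_eq_zero.1 this).resolve_left h
    have fin : ∀ p q : ℝ, (p ≠ 0 ∨ q ≠ 0) → (![0, q, 0, -p] : Pt) ∈ K →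
        (∀ v ∈ K, p * v 1 + q * v 3 = 0) → Module.finrank ℝ K = 1 := by
      intro p q hpq hm hv
      refine finrank_eq_one_iff'.2 ⟨⟨_, hm⟩, ?_, ?_⟩
      · intro h
        have h' : (![0, q, 0, -p] : Pt) = 0 := congrArg Subtype.val h
        have q1 := congrFun h' 1
        have q3 := congrFun h' 3
        simp at q1 q3
        tauto
      · rintro ⟨w, hw⟩
        obtain ⟨w0, w2⟩ := v02 w hw
        have e := hv w hw
        rcases hpq with h | h
        · refine ⟨-(w 3) / p, Subtype.ext ?_⟩
          ext i
          fin_cases i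
          · simp [w0]
          · simp; field_simp; linear_combination -e
          · simp [w2]
          · simp; field_simp
        · refine ⟨(w 1) / q, Subtype.ext ?_⟩
          ext i
          fin_cases i
          · simp [w0]
          · simp; field_simp
          · simp [w2]
          · simp; field_simp; linear_combination -e
    by_cases hA : a1 ≠ 0 ∨ a3 ≠ 0
    · refine fin a1 a3 hA (n1 hD) fun v hv => ?_
      have e2 := ((hK v).1 hv).2.1
      rw [(v02 v hv).2] at e2
      linear_combination e2
    · push Not at hA
      refine fin b1 b3 ?_ (n2 hD) fun v hv => ?_
      · rw [hA.1, hA.2] at hPQ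
        by_contra! hb
        rw [hb.1, hb.2] at hPQ
        simp at hPQ
      · have e4 := ((hK v).1 hv).2.2.2.1
        rw [(v02 v hv).1] at e4
        linear_combination e4

lemma theta_formula
    (F : Pt → ℝ) (hFs : ContDiff ℝ (⊤ : ℕ∞) F)
    (Ω : Form2)
    (hΩ : ∀ x i j, Ω x i j =
      (F x)⁻¹ * (Real.exp ((1 + x 0) * x 2) * dxw 0 1 i j + dxw 2 3 i j))
    (W : Set Pt) (hW : IsOpen W)
    (hΩr : ∀ x ∈ W, w22 Ω Ω x ≠ 0)
    (ω : Form1) (hω : ∀ x ∈ W, w12 ω Ω x = d2 Ω x)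
    (θ : Form1) (hθ : ∀ x ∈ W, w12 θ Ω x = w12 ω (d1 ω) x) (x : Pt) (hx : x ∈ W) :
    θ x 0 = - pd 3 F x ∧ θ x 1 = 0 ∧ θ x 2 = pd 1 F x * Real.exp (-((1 + x 0) * x 2)) ∧
      θ x 3 = 0 := by
  have hFn : ∀ x ∈ W, F x ≠ 0 := by
    intro x hx h
    apply hΩr x hx
    ext i j k l
    simp [w22, hΩ, h]
  have hFd : Differentiable ℝ F := hFs.differentiable (by simp)
  have hΩd : ∀ x ∈ W, ∀ i j k, pd i (fun y => Ω y j k) x =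
      (- pd i F x * ((F x)⁻¹) ^ 2) * (Real.exp ((1 + x 0) * x 2) * dxw 0 1 j k + dxw 2 3 j k)
      + (F x)⁻¹ * (Real.exp ((1 + x 0) * x 2) * ((if 0 = i then 1 else 0) * x 2
        + (1 + x 0) * (if 2 = i then 1 else 0)) * dxw 0 1 j k) := by
    intro x hx i j k
    have : (fun y => Ω y j k) = fun y => (F y)⁻¹ *
        (Real.exp ((1 + y 0) * y 2) * dxw 0 1 j k + dxw 2 3 j k) := by
      funext y; exact hΩ y j k
    have hi : DifferentiableAt ℝ (fun y => (F y)⁻¹) x := (hFd x).inv (hFn x hx)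
    have hg : DifferentiableAt ℝ (fun y : Pt =>
        Real.exp ((1 + y 0) * y 2) * dxw 0 1 j k + dxw 2 3 j k) x := by fun_prop
    rw [this, pd_mul i hi hg, pd_inv i (hFd x) (hFn x hx),
      pd_add i (by fun_prop) (by fun_prop), pd_mul i (by fun_prop) (by fun_prop), pd_const,
      pd_const, pd_exp i (by fun_prop), pd_phase]
    ring
  have hωf : ∀ x ∈ W, ∀ i, ω x i = - (pd i F x * (F x)⁻¹) + (if 2 = i then 1 else 0) * (1 + x 0) := by
    intro x hx i
    have h := hω x hx
    have hF := hFn x hx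
    have hE := (Real.exp_pos ((1 + x 0) * x 2)).ne'
    have c012 := congrFun (congrFun (congrFun h 0) 1) 2
    have c013 := congrFun (congrFun (congrFun h 0) 1) 3
    have c023 := congrFun (congrFun (congrFun h 0) 2) 3
    have c123 := congrFun (congrFun (congrFun h 1) 2) 3
    simp only [w12, d2, hΩd x hx] at c012 c013 c023 c123
    simp only [hΩ] at c012 c013 c023 c123
    simp [dxw] at c012 c013 c023 c123
    generalize Real.exp ((1 + x 0) * x 2) = E at *
    field_simp at c012 c013 c023 c123
    fin_cases i <;> simp <;> field_simp <;> linarith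
  have hωd : ∀ x ∈ W, ∀ i j, d1 ω x i j =
      (if 0 = i then 1 else 0) * (if 2 = j then 1 else 0)
      - (if 0 = j then 1 else 0) * (if 2 = i then 1 else 0) := by
    intro x hx i j
    have key : ∀ i j, pd i (fun y => ω y j) x =
        - (pd2 i j F x * (F x)⁻¹ + pd j F x * (- pd i F x * ((F x)⁻¹) ^ 2))
        + (if 2 = j then 1 else 0) * (if 0 = i then 1 else 0) := by
      intro i j
      have hev : (fun y => ω y j) =ᶠ[nhds x] fun y => - (pd j F y * (F y)⁻¹)
          + (if 2 = j then 1 else 0) * (1 + y 0) := by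
        filter_upwards [hW.mem_nhds hx] with y hy using hωf y hy j
      have hp : DifferentiableAt ℝ (fun y => pd j F y) x :=
        (contDiff_pd hFs j).differentiable (by simp) x
      have hi : DifferentiableAt ℝ (fun y => (F y)⁻¹) x := (hFd x).inv (hFn x hx)
      have hm : DifferentiableAt ℝ (fun y => - (pd j F y * (F y)⁻¹)) x := (hp.mul hi).neg
      rw [pd_congr i hev, pd_add i hm (by fun_prop), pd_neg, pd_mul i hp hi,
        pd_inv i (hFd x) (hFn x hx), pd_mul i (by fun_prop) (by fun_prop), pd_const,
        pd_add i (by fun_prop) (by fun_prop), pd_const, pd_coord]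
      simp [pd2]
    unfold d1
    rw [key, key, pd2_symm hFs i j]
    ring
  have h := hθ x hx
  have hF := hFn x hx
  have hE := (Real.exp_pos ((1 + x 0) * x 2)).ne'
  have c012 := congrFun (congrFun (congrFun h 0) 1) 2
  have c013 := congrFun (congrFun (congrFun h 0) 1) 3
  have c023 := congrFun (congrFun (congrFun h 0) 2) 3
  have c123 := congrFun (congrFun (congrFun h 1) 2) 3
  simp only [w12, hωd x hx, hωf x hx, hΩ] at c012 c013 c023 c123
  simp [dxw] at c012 c013 c023 c123
  rw [Real.exp_neg]
  generalize Real.exp ((1 + x 0) * x 2) = E at *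
  refine ⟨?_, ?_, ?_, ?_⟩
  · field_simp at c023; linarith
  · simpa [hF] using c123
  · field_simp at c012 ⊢; linarith
  · simpa [hF, hE] using c013

lemma class_point
    (F : Pt → ℝ) (hFs : ContDiff ℝ (⊤ : ℕ∞) F)
    (W : Set Pt) (hW : IsOpen W) (θ : Form1)
    (hf : ∀ x ∈ W, θ x 0 = - pd 3 F x ∧ θ x 1 = 0 ∧
      θ x 2 = pd 1 F x * Real.exp (-((1 + x 0) * x 2)) ∧ θ x 3 = 0) (x : Pt) (hx : x ∈ W) :
    (classAt θ x = 4 ↔ pd2 1 1 F x * pd2 3 3 F x - (pd2 1 3 F x) ^ 2 ≠ 0) ∧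
    (classAt θ x = 3 ↔ pd2 1 1 F x * pd2 3 3 F x - (pd2 1 3 F x) ^ 2 = 0 ∧
      (pd 1 F x * pd2 1 3 F x - pd 3 F x * pd2 1 1 F x) ^ 2
          + (pd 1 F x * pd2 3 3 F x - pd 3 F x * pd2 1 3 F x) ^ 2 > 0) := by
  have hWx := hW.mem_nhds hx
  have t0 : ∀ i, pd i (fun y => θ y 0) x = - pd2 i 3 F x := by
    intro i
    have : (fun y => θ y 0) =ᶠ[nhds x] fun y => - pd 3 F y := by
      filter_upwards [hWx] with y hy using (hf y hy).1
    rw [pd_congr i this, pd_neg]; rfl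
  have t1 : ∀ i, pd i (fun y => θ y 1) x = 0 := by
    intro i
    have : (fun y => θ y 1) =ᶠ[nhds x] fun y => 0 := by
      filter_upwards [hWx] with y hy using (hf y hy).2.1
    rw [pd_congr i this, pd_const]
  have t3 : ∀ i, pd i (fun y => θ y 3) x = 0 := by
    intro i
    have : (fun y => θ y 3) =ᶠ[nhds x] fun y => 0 := by
      filter_upwards [hWx] with y hy using (hf y hy).2.2.2
    rw [pd_congr i this, pd_const]
  have t2 : ∀ i, pd i (fun y => θ y 2) x = pd2 i 1 F x * Real.exp (-((1 + x 0) * x 2))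
      - pd 1 F x * (Real.exp (-((1 + x 0) * x 2)) * ((if 0 = i then 1 else 0) * x 2
        + (1 + x 0) * (if 2 = i then 1 else 0))) := by
    intro i
    have : (fun y => θ y 2) =ᶠ[nhds x] fun y => pd 1 F y * Real.exp (-((1 + y 0) * y 2)) := by
      filter_upwards [hWx] with y hy using (hf y hy).2.2.1
    have hp : DifferentiableAt ℝ (fun y => pd 1 F y) x :=
      (contDiff_pd hFs 1).differentiable (by simp) x
    rw [pd_congr i this, pd_mul i hp (by fun_prop), pd_exp i (by fun_prop), pd_neg, pd_phase]
    simp only [pd2]; ring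
  obtain ⟨f0, f1, f2, f3⟩ := hf x hx
  have main := class_lin (- pd 3 F x) (pd 1 F x * Real.exp (-((1 + x 0) * x 2)))
    (- pd2 1 3 F x) (- pd2 3 3 F x) (pd2 1 1 F x * Real.exp (-((1 + x 0) * x 2)))
    (pd2 1 3 F x * Real.exp (-((1 + x 0) * x 2))) (d1 θ x 0 2)
    (LinearMap.ker (covec (θ x)) ⊓ ⨅ j, LinearMap.ker (covec (fun i => d1 θ x i j))) (by
      intro v
      have d20 : d1 θ x 2 0 = - d1 θ x 0 2 := by simp [d1]
      generalize hc : d1 θ x 0 2 = c at *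
      have d00 : ∀ i, d1 θ x i i = 0 := by intro i; simp [d1]
      have d01 : d1 θ x 0 1 = pd2 1 3 F x := by simp [d1, t0, t1]
      have d10 : d1 θ x 1 0 = - pd2 1 3 F x := by simp [d1, t0, t1]
      have d03 : d1 θ x 0 3 = pd2 3 3 F x := by simp [d1, t0, t3]
      have d30 : d1 θ x 3 0 = - pd2 3 3 F x := by simp [d1, t0, t3]
      have d12 : d1 θ x 1 2 = pd2 1 1 F x * Real.exp (-((1 + x 0) * x 2)) := by
        simp [d1, t1, t2]
      have d21 : d1 θ x 2 1 = -(pd2 1 1 F x * Real.exp (-((1 + x 0) * x 2))) := by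
        simp [d1, t1, t2]
      have d32 : d1 θ x 3 2 = pd2 1 3 F x * Real.exp (-((1 + x 0) * x 2)) := by
        simp [d1, t3, t2, pd2_symm hFs 3 1]
      have d23 : d1 θ x 2 3 = -(pd2 1 3 F x * Real.exp (-((1 + x 0) * x 2))) := by
        simp [d1, t3, t2, pd2_symm hFs 3 1]
      have d13 : d1 θ x 1 3 = 0 := by simp [d1, t1, t3]
      have d31 : d1 θ x 3 1 = 0 := by simp [d1, t1, t3]
      simp only [Submodule.mem_inf, Submodule.mem_iInf, LinearMap.mem_ker, covec,
        Fin.forall_fin_succ, Fin.sum_univ_four, LinearMap.add_apply, LinearMap.smul_apply,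
        LinearMap.proj_apply, smul_eq_mul, Fin.succ_zero_eq_one, Fin.succ_one_eq_two,
        IsEmpty.forall_iff, and_true, f0, f1, f2, f3]
      rw [show (Fin.succ 2 : Fin 4) = 3 from rfl]
      simp only [d00, d01, d10, d03, d30, d12, d21, d32, d23, d13, d31, d20, hc]
      constructor
      · rintro ⟨h1, h2, h3, h4, h5⟩
        refine ⟨?_, ?_, ?_, ?_, ?_⟩ <;> linarith
      · rintro ⟨h1, h2, h3, h4, h5⟩
        refine ⟨?_, ?_, ?_, ?_, ?_⟩ <;> linarith)
  have hE := (Real.exp_pos (-((1 + x 0) * x 2))).ne'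
  generalize Real.exp (-((1 + x 0) * x 2)) = E at *
  have r1 : - pd2 1 3 F x * (pd2 1 3 F x * E) - - pd2 3 3 F x * (pd2 1 1 F x * E)
      = (pd2 1 1 F x * pd2 3 3 F x - (pd2 1 3 F x) ^ 2) * E := by ring
  have r2 : - pd 3 F x * (pd2 1 1 F x * E) - pd 1 F x * E * - pd2 1 3 F x
      = (pd 1 F x * pd2 1 3 F x - pd 3 F x * pd2 1 1 F x) * E := by ring
  have r3 : - pd 3 F x * (pd2 1 3 F x * E) - pd 1 F x * E * - pd2 3 3 F x
      = (pd 1 F x * pd2 3 3 F x - pd 3 F x * pd2 1 3 F x) * E := by ring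
  rw [r1, r2, r3] at main
  unfold classAt
  refine ⟨main.1.trans (by simp [hE]), main.2.trans ?_⟩
  have hs : ∀ p q : ℝ, (p * E ≠ 0 ∨ q * E ≠ 0) ↔ p ^ 2 + q ^ 2 > 0 := by
    intro p q
    constructor
    · rintro (h | h)
      · have : p ≠ 0 := left_ne_zero_of_mul h
        positivity
      · have : q ≠ 0 := left_ne_zero_of_mul h
        positivity
    · intro h
      by_contra! h'
      have hp : p = 0 := (mul_eq_zero.1 h'.1).resolve_right hE
      have hq : q = 0 := (mul_eq_zero.1 h'.2).resolve_right hE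
      simp [hp, hq] at h
  rw [hs]
  simp [hE]

/-- Proposition `finer_class`, cases `3.3` and `3.4`. For a germ of a
2-form of type 3 at the origin written as `Ω = F⁻¹·( exp((1+x¹)x³) dx¹∧dx² + dx³∧dx⁴ )`
with `F(0) = 1`: `Ω` is of type `3.3` iff
`(F_{x²}F_{x²x⁴} − F_{x⁴}F_{x²x²})²(0) + (F_{x²}F_{x⁴x⁴} − F_{x⁴}F_{x²x⁴})²(0) > 0` and
`F_{x²x²}F_{x⁴x⁴} − (F_{x²x⁴})² = 0` identically near the origin; and `Ω` is of type `3.4`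
iff `F_{x²x²}(0)F_{x⁴x⁴}(0) − (F_{x²x⁴}(0))² ≠ 0`. -/
theorem type33_type34_criterion
    (F : Pt → ℝ) (hFs : ContDiff ℝ (⊤ : ℕ∞) F) (hF0 : F 0 = 1)
    (Ω : Form2)
    (hΩ : ∀ x i j, Ω x i j =
      (F x)⁻¹ * (Real.exp ((1 + x 0) * x 2) * dxw 0 1 i j + dxw 2 3 i j))
    (W : Set Pt) (hW : IsOpen W) (h0W : (0 : Pt) ∈ W)
    (hΩr : ∀ x ∈ W, w22 Ω Ω x ≠ 0)
    (ω : Form1) (hωs : ContDiffOn ℝ (⊤ : ℕ∞) ω W)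
    (hω : ∀ x ∈ W, w12 ω Ω x = d2 Ω x)
    (θ : Form1) (hθs : ContDiffOn ℝ (⊤ : ℕ∞) θ W)
    (hθ : ∀ x ∈ W, w12 θ Ω x = w12 ω (d1 ω) x)
    (htype : IsTypeAt ω 3 0) :
    -- type 3.3 criterion
    ((∀ᶠ x in nhds (0 : Pt), classAt θ x = 3) ↔
      ((pd 1 F 0 * pd2 1 3 F 0 - pd 3 F 0 * pd2 1 1 F 0) ^ 2
          + (pd 1 F 0 * pd2 3 3 F 0 - pd 3 F 0 * pd2 1 3 F 0) ^ 2 > 0 ∧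
        ∀ᶠ x in nhds (0 : Pt),
          pd2 1 1 F x * pd2 3 3 F x - (pd2 1 3 F x) ^ 2 = 0)) ∧
    -- type 3.4 criterion
    ((∀ᶠ x in nhds (0 : Pt), classAt θ x = 4) ↔
      pd2 1 1 F 0 * pd2 3 3 F 0 - (pd2 1 3 F 0) ^ 2 ≠ 0) := by
  have hcl := class_point F hFs W hW θ
    (theta_formula F hFs Ω hΩ W hW hΩr ω hω θ hθ)
  have hWn := hW.mem_nhds h0W
  have c1 : ∀ i, Continuous (fun y => pd i F y) := fun i => (contDiff_pd hFs i).continuous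
  have c2 : ∀ i j, Continuous (fun y => pd2 i j F y) := fun i j =>
    (contDiff_pd (contDiff_pd hFs j) i).continuous
  have p1 := c1 1
  have p3 := c1 3
  have p11 := c2 1 1
  have p13 := c2 1 3
  have p33 := c2 3 3
  refine ⟨⟨fun h => ⟨?_, ?_⟩, ?_⟩, ⟨fun h => ?_, fun h => ?_⟩⟩
  · exact (((hcl 0 h0W).2).1 h.self_of_nhds).2
  · filter_upwards [h, hWn] with y hy hyW using (((hcl y hyW).2).1 hy).1
  · rintro ⟨hpos, hdet⟩
    have hc : Continuous (fun x => (pd 1 F x * pd2 1 3 F x - pd 3 F x * pd2 1 1 F x) ^ 2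
          + (pd 1 F x * pd2 3 3 F x - pd 3 F x * pd2 1 3 F x) ^ 2) := by fun_prop
    filter_upwards [hdet, hWn, hc.continuousAt.eventually (lt_mem_nhds hpos)] with y hy hyW hp
    exact ((hcl y hyW).2).2 ⟨hy, hp⟩
  · exact ((hcl 0 h0W).1).1 h.self_of_nhds
  · have hc : Continuous (fun x => pd2 1 1 F x * pd2 3 3 F x - (pd2 1 3 F x) ^ 2) := by fun_prop
    filter_upwards [hWn, hc.continuousAt.eventually_ne h] with y hyW hp
    exact ((hcl y hyW).1).2 hp
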